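/- arXiv:1407.4269 — 6 statements merged into one kernel-verified Lean document; each statement's English description precedes it below -/
import Mathlib

section
/- Set M := {(0,c,0) : c ∈ ℤ⁶} ⊆ Λ₈, and let y = kδ + (2n+2)l with k ∈ ℤ and l ∈ M. Then: (i) there exists t ∈ Λ₈ with (2n+2)t = v + y if and only if k ≡ −1 (mod 2n+2); (ii) there exists t ∈ Λ₈ with (2n+2)t = v − y if and only if k ≡ 1 (mod 2n+2). -/
/-- The lattice `Λ₈ = ℤ ⊕ ℤ⁶ ⊕ ℤ`, the Mukai lattice of an abelian surface. -/
abbrev Lambda8 : Type := ℤ × (Fin 6 → ℤ) × ℤ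

/-- The orthogonal sum of three hyperbolic planes on `ℤ⁶`. -/
def hyp6 (c c' : Fin 6 → ℤ) : ℤ :=
  c 0 * c' 1 + c 1 * c' 0 + c 2 * c' 3 + c 3 * c' 2 + c 4 * c' 5 + c 5 * c' 4

/-- The Mukai pairing on `Λ₈`. -/
def b8 (x y : Lambda8) : ℤ := hyp6 x.2.1 y.2.1 - x.1 * y.2.2 - y.1 * x.2.2

/-- The Mukai vector `v = (1,0,-(n+1))`. -/
def vv (n : ℤ) : Lambda8 := (1, 0, -(n + 1))

/-- The class `δ = (1,0,n+1)`, half the exceptional divisor of the Hilbert–Chow morphism. -/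
def dd (n : ℤ) : Lambda8 := (1, 0, n + 1)

/-- The isotropic class `s = (0,0,-1)`. -/
def ss : Lambda8 := (0, 0, -1)

theorem stmt4 (n : ℤ) (hn : 1 ≤ n) (k : ℤ) (l : Lambda8)
    (hl : l.1 = 0 ∧ l.2.2 = 0) :
    ((∃ t : Lambda8, (2 * n + 2) • t = vv n + (k • dd n + (2 * n + 2) • l)) ↔
      k ≡ -1 [ZMOD (2 * n + 2)]) ∧
    ((∃ t : Lambda8, (2 * n + 2) • t = vv n - (k • dd n + (2 * n + 2) • l)) ↔
      k ≡ 1 [ZMOD (2 * n + 2)]) := by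
  obtain ⟨r, c, t⟩ := l
  obtain ⟨rfl, rfl⟩ : r = 0 ∧ t = 0 := hl
  simp only [Int.modEq_iff_dvd, vv, dd]
  refine ⟨⟨?_, ?_⟩, ⟨?_, ?_⟩⟩
  · rintro ⟨x, hx⟩
    have h := congrArg Prod.fst hx
    simp at h
    exact ⟨-x.1, by linarith⟩
  · rintro ⟨m, hm⟩
    obtain rfl : k = -1 - (2 * n + 2) * m := by linarith
    refine ⟨(-m, c, -1 - (n + 1) * m), Prod.ext ?_ (Prod.ext ?_ ?_)⟩ <;> simp <;> ring
  · rintro ⟨x, hx⟩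
    have h := congrArg Prod.fst hx
    simp at h
    exact ⟨x.1, by linarith⟩
  · rintro ⟨m, hm⟩
    obtain rfl : k = 1 - (2 * n + 2) * m := by linarith
    refine ⟨(m, -c, -1 + (n + 1) * m), Prod.ext ?_ (Prod.ext ?_ ?_)⟩ <;> simp <;> ring
end

section
/- Set v^⊥ := {x ∈ Λ₈ : b(x,v) = 0} and M := {(0,c,0) : c ∈ ℤ⁶}. Let g : v^⊥ → v^⊥ be an isometry of v^⊥, i.e. a ℤ-linear bijection with b(g(x),g(y)) = b(x,y) for all x,y ∈ v^⊥. Then there exist k ∈ ℤ and l ∈ M such that g(δ) = kδ + (2n+2)l. -/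
/-- The orthogonal complement `v^⊥ ⊆ Λ₈`, a model for the second cohomology of a
generalised Kummer manifold of dimension `2n`. -/
def Vperp (n : ℤ) : Submodule ℤ Lambda8 where
  carrier := {x : Lambda8 | b8 x (vv n) = 0}
  add_mem' := by
    intro a b ha hb
    simp only [Set.mem_setOf_eq, b8, hyp6, vv, Prod.fst_add, Prod.snd_add,
      Pi.add_apply, Pi.zero_apply, mul_zero, zero_mul] at *
    linarith
  zero_mem' := by
    simp [b8, hyp6, vv]
  smul_mem' := by
    intro m a ha
    simp only [Set.mem_setOf_eq, b8, hyp6, vv, Prod.smul_fst, Prod.smul_snd,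
      Pi.smul_apply, smul_eq_mul, Pi.zero_apply, mul_zero, zero_mul] at *
    linear_combination m * ha

theorem mem_Vperp_iff {n : ℤ} {x : Lambda8} : x ∈ Vperp n ↔ x.2.2 = (n + 1) * x.1 := by
  change b8 x (vv n) = 0 ↔ _
  simp only [b8, hyp6, vv, Pi.zero_apply, mul_zero, add_zero]
  constructor <;> intro h <;> linarith

/-- The class `δ` has divisibility `2n + 2` in `v^⊥`. -/
theorem dvd_b8_dd {n : ℤ} {x : Lambda8} (hx : x ∈ Vperp n) : 2 * n + 2 ∣ b8 (dd n) x := by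
  refine ⟨-x.1, ?_⟩
  simp only [b8, hyp6, dd, Pi.zero_apply, zero_mul, mem_Vperp_iff.1 hx]
  ring

/-- An element of `v^⊥` whose divisibility is a multiple of `m` has its `ℤ⁶`-component in
`m ℤ⁶`. -/
theorem dvd_component_of_dvd_b8 {n m : ℤ} {x : Lambda8}
    (h : ∀ y ∈ Vperp n, m ∣ b8 x y) (i : Fin 6) : m ∣ x.2.1 i := by
  have key (j : Fin 6) : m ∣ hyp6 x.2.1 (Pi.single j 1) := by
    simpa [b8] using h (0, Pi.single j 1, 0) (by simp [mem_Vperp_iff])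
  fin_cases i
  · simpa [hyp6, Pi.single_apply] using key 1
  · simpa [hyp6, Pi.single_apply] using key 0
  · simpa [hyp6, Pi.single_apply] using key 3
  · simpa [hyp6, Pi.single_apply] using key 2
  · simpa [hyp6, Pi.single_apply] using key 5
  · simpa [hyp6, Pi.single_apply] using key 4

theorem stmt5 (n : ℤ) (hn : 1 ≤ n) (hδ : dd n ∈ Vperp n)
    (g : Vperp n ≃ₗ[ℤ] Vperp n)
    (hg : ∀ x y : Vperp n, b8 ((g x : Vperp n) : Lambda8) ((g y : Vperp n) : Lambda8)
      = b8 (x : Lambda8) (y : Lambda8)) :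
    ∃ (k : ℤ) (l : Lambda8), (l.1 = 0 ∧ l.2.2 = 0) ∧
      ((g ⟨dd n, hδ⟩ : Vperp n) : Lambda8) = k • dd n + (2 * n + 2) • l := by
  have hdvd : ∀ y ∈ Vperp n, 2 * n + 2 ∣ b8 (g ⟨dd n, hδ⟩ : Vperp n) y := fun y hy => by
    have h := hg ⟨dd n, hδ⟩ (g.symm ⟨y, hy⟩)
    rw [LinearEquiv.apply_symm_apply] at h
    exact h ▸ dvd_b8_dd (g.symm ⟨y, hy⟩).2
  choose l hl using dvd_component_of_dvd_b8 hdvd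
  refine ⟨(g ⟨dd n, hδ⟩ : Vperp n).1.1, (0, l, 0), ⟨rfl, rfl⟩, ?_⟩
  refine Prod.ext (by simp [dd]) (Prod.ext (funext fun i => by simpa [dd] using hl i) ?_)
  simpa [dd, mul_comm] using mem_Vperp_iff.1 (g ⟨dd n, hδ⟩).2
end

section
/- Set v^⊥ := {x ∈ Λ₈ : b(x,v) = 0}, and extend b to a ℚ-bilinear form on ℚ ⊗ Λ₈. Let D := {x ∈ ℚ ⊗ Λ₈ : x lies in the ℚ-span of v^⊥ and b(x,y) ∈ ℤ for all y ∈ v^⊥} be the dual lattice of v^⊥. Then the quotient abelian group D / v^⊥ (the discriminant group of v^⊥) is cyclic of order 2n+2, generated by the class of δ/(2n+2). -/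
/-- The rational Mukai lattice `ℚ ⊗ Λ₈`. -/
abbrev Q8 : Type := ℚ × (Fin 6 → ℚ) × ℚ

/-- The Mukai pairing extended to `ℚ ⊗ Λ₈`. -/
def bQ (x y : Q8) : ℚ :=
  x.2.1 0 * y.2.1 1 + x.2.1 1 * y.2.1 0 + x.2.1 2 * y.2.1 3 + x.2.1 3 * y.2.1 2 +
    x.2.1 4 * y.2.1 5 + x.2.1 5 * y.2.1 4 - x.1 * y.2.2 - y.1 * x.2.2

/-- The natural embedding `Λ₈ → ℚ ⊗ Λ₈`. -/
def ι : Lambda8 → Q8 := fun x => ((x.1 : ℚ), fun i => (x.2.1 i : ℚ), (x.2.2 : ℚ))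

theorem b8_vv_eq_zero_iff (n : ℤ) (y : Lambda8) :
    b8 y (vv n) = 0 ↔ y.2.2 = (n + 1) * y.1 := by
  simp only [b8, vv, hyp6, Pi.zero_apply]
  constructor <;> intro h <;> linarith

theorem snd_snd_of_mem_span (n : ℤ) {x : Q8}
    (hx : x ∈ Submodule.span ℚ (ι '' {y : Lambda8 | b8 y (vv n) = 0})) :
    x.2.2 = ((n : ℚ) + 1) * x.1 := by
  induction hx using Submodule.span_induction with
  | mem x h =>
    obtain ⟨y, hy, rfl⟩ := h
    have := (b8_vv_eq_zero_iff n y).1 hy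
    simp [ι, this]
  | zero => simp
  | add x y _ _ hx hy => simp [hx, hy, mul_add]
  | smul a x _ hx => simp only [Prod.smul_fst, Prod.smul_snd, smul_eq_mul, hx]; ring

theorem dd_mem_vv_orthogonal (n : ℤ) : b8 (dd n) (vv n) = 0 := by
  simp [b8_vv_eq_zero_iff, dd]

/-- The pairing with `δ` reads off the rank on the rational span of `v^⊥`. -/
theorem bQ_dd (n : ℤ) {x : Q8} (hx : x.2.2 = ((n : ℚ) + 1) * x.1) :
    bQ x (ι (dd n)) = -((2 * (n : ℚ) + 2) * x.1) := by
  simp only [bQ, ι, dd, hx, Pi.zero_apply]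
  push_cast
  ring

theorem bQ_smul_dd (n : ℤ) (hN : 2 * (n : ℚ) + 2 ≠ 0) {y : Lambda8} (hy : b8 y (vv n) = 0) :
    bQ ((2 * (n : ℚ) + 2)⁻¹ • ι (dd n)) (ι y) = -y.1 := by
  rw [b8_vv_eq_zero_iff] at hy
  simp only [bQ, ι, dd, hy, Prod.smul_fst, Prod.smul_snd, smul_eq_mul, Pi.smul_apply,
    Pi.zero_apply]
  push_cast
  linear_combination -(y.1 : ℚ) * inv_mul_cancel₀ hN

/-- A vector of `ℚ⁶` pairing integrally with `U³ ⊆ v^⊥` is integral, since `U³` is unimodular. -/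
theorem exists_int_of_bQ_int (n : ℤ) {x : Q8}
    (hx : ∀ y : Lambda8, b8 y (vv n) = 0 → ∃ m : ℤ, bQ x (ι y) = m) (i : Fin 6) :
    ∃ m : ℤ, x.2.1 i = m := by
  obtain ⟨m, hm⟩ := hx (0, Pi.single (![1, 0, 3, 2, 5, 4] i) 1, 0)
    (by simp [b8_vv_eq_zero_iff])
  refine ⟨m, hm ▸ ?_⟩
  fin_cases i <;> simp [bQ, ι, Pi.single_apply]


theorem stmt7 (n : ℤ) (hn : 1 ≤ n) :
    -- the dual lattice of `v^⊥` inside `ℚ ⊗ Λ₈`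
    ∀ Dual : Set Q8, Dual = {x : Q8 |
        x ∈ Submodule.span ℚ (ι '' {y : Lambda8 | b8 y (vv n) = 0}) ∧
        ∀ y : Lambda8, b8 y (vv n) = 0 → ∃ m : ℤ, bQ x (ι y) = m} →
      -- the class of `δ/(2n+2)` generates the discriminant group `D/v^⊥`,
      -- which is cyclic of order `2n+2`
      ((2 * (n : ℚ) + 2)⁻¹ • ι (dd n) ∈ Dual) ∧
      (∀ x ∈ Dual, ∃ j : ℤ,
        x - j • ((2 * (n : ℚ) + 2)⁻¹ • ι (dd n)) ∈ ι '' {y : Lambda8 | b8 y (vv n) = 0}) ∧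
      (∀ j : ℤ,
        (j • ((2 * (n : ℚ) + 2)⁻¹ • ι (dd n)) ∈ ι '' {y : Lambda8 | b8 y (vv n) = 0}) ↔
          (2 * n + 2) ∣ j) := by
  have hN : 2 * (n : ℚ) + 2 ≠ 0 := by
    have : (1 : ℚ) ≤ n := by exact_mod_cast hn
    positivity
  rintro Dual rfl
  refine ⟨⟨?_, fun y hy => ⟨-y.1, ?_⟩⟩, ?_, fun j => ⟨?_, ?_⟩⟩
  · exact Submodule.smul_mem _ _ (Submodule.subset_span ⟨_, dd_mem_vv_orthogonal n, rfl⟩)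
  · rw [bQ_smul_dd n hN hy]
    push_cast
    rfl
  · rintro x ⟨hspan, hint⟩
    have hx := snd_snd_of_mem_span n hspan
    obtain ⟨m, hm⟩ := hint _ (dd_mem_vv_orthogonal n)
    rw [bQ_dd n hx] at hm
    choose c hc using exists_int_of_bQ_int n hint
    have hr : x.1 = -m * (2 * (n : ℚ) + 2)⁻¹ := by
      rw [← hm]
      field_simp
    refine ⟨-m, (0, c, 0), by simp [b8_vv_eq_zero_iff], ?_⟩
    refine Prod.ext ?_ (Prod.ext (funext fun i => ?_) ?_)
    · simp [ι, dd, hr]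
    · simp [ι, dd, hc]
    · simp [ι, dd, hx, hr]
      ring
  · rintro ⟨y, -, hy⟩
    have h : (y.1 : ℚ) = j * (2 * (n : ℚ) + 2)⁻¹ := by
      simpa [ι, dd] using congrArg Prod.fst hy
    refine ⟨y.1, ?_⟩
    have : (j : ℚ) = (2 * n + 2) * y.1 := by
      rw [h]
      field_simp
    exact_mod_cast this
  · rintro ⟨k, rfl⟩
    refine ⟨k • dd n, ?_, ?_⟩
    · rw [Set.mem_ofPred_eq, b8_vv_eq_zero_iff]
      simp [dd, mul_comm]
    · refine Prod.ext ?_ (Prod.ext (funext fun i => ?_) ?_)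
      · simp [ι, dd]
        field_simp
      · simp [ι, dd]
      · simp [ι, dd]
        field_simp
end

section
/- Set v^⊥ := {x ∈ Λ₈ : b(x,v) = 0}, and let w₂ := (2,(4n,1,0,0,0,0),2n) ∈ Λ₈. Then w₂ is primitive, b(w₂,w₂) = 0 and b(v,w₂) = 2, and the vector D₂ := v − (n+1)w₂ satisfies b(D₂,v) = 0, b(D₂,D₂) = −(2n+2), n+1 divides b(D₂,x) for every x ∈ v^⊥, and there exists x₀ ∈ v^⊥ with b(D₂,x₀) = n+1. Hence the divisibility of D₂ in v^⊥ (the positive generator of the ideal b(D₂,v^⊥) ⊆ ℤ) equals n+1. -/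
/-- The isotropic Mukai vector `w₂ = (2,(4n,1,0,0,0,0),2n)` with `b(v,w₂) = 2`
(a divisorial contraction of type II). -/
def w2 (n : ℤ) : Lambda8 := (2, ![4 * n, 1, 0, 0, 0, 0], 2 * n)

theorem stmt10 (n : ℤ) (hn : 1 ≤ n) :
    (¬ ∃ (m : ℤ) (x : Lambda8), 2 ≤ |m| ∧ w2 n = m • x) ∧
    b8 (w2 n) (w2 n) = 0 ∧
    b8 (vv n) (w2 n) = 2 ∧
    b8 (vv n - (n + 1) • w2 n) (vv n) = 0 ∧
    b8 (vv n - (n + 1) • w2 n) (vv n - (n + 1) • w2 n) = -(2 * n + 2) ∧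
    (∀ x : Lambda8, b8 x (vv n) = 0 → (n + 1) ∣ b8 (vv n - (n + 1) • w2 n) x) ∧
    (∃ x₀ : Lambda8, b8 x₀ (vv n) = 0 ∧ b8 (vv n - (n + 1) • w2 n) x₀ = n + 1) := by
  refine ⟨?_, ?_, ?_, ?_, ?_, ?_, ?_⟩
  · rintro ⟨m, x, hm, hx⟩
    have h : (1 : ℤ) = m * x.2.1 1 := by
      simpa [w2] using congrArg (fun y : Lambda8 => y.2.1 1) hx
    have h1 : |m| = 1 := Int.isUnit_iff_abs_eq.mp (IsUnit.of_mul_eq_one _ h.symm)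
    omega
  · simp [b8, hyp6, w2]
    ring
  · simp [b8, hyp6, w2, vv]
    ring
  · simp [b8, hyp6, w2, vv]
    ring
  · simp [b8, hyp6, w2, vv]
    ring
  · intro x hx
    refine ⟨-b8 (w2 n) x, ?_⟩
    simp [b8, hyp6, w2, vv] at hx ⊢
    linear_combination hx
  · refine ⟨(0, ![-1, 0, 0, 0, 0, 0], 0), ?_, ?_⟩ <;> simp [b8, hyp6, w2, vv]
end

section
/- Set v^⊥ := {x ∈ Λ₈ : b(x,v) = 0}, let w₂ := (2,(4n,1,0,0,0,0),2n) and D₂ := v − (n+1)w₂. Then, for n ≥ 1, there is no isometry g of v^⊥ (a ℤ-linear bijection of v^⊥ preserving b) with g(δ) = D₂: although b(δ,δ) = b(D₂,D₂) = −(2n+2), the divisibilities of δ and D₂ in v^⊥ are 2n+2 and n+1 respectively, so δ and D₂ lie in different orbits of the isometry group of v^⊥. (This shows the wall divisors of divisorial contractions of type I and type II on a generalised Kummer manifold lie in different monodromy orbits.) -/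
theorem b8_dd {n : ℤ} {x : Lambda8} (hx : x ∈ Vperp n) :
    b8 (dd n) x = (2 * n + 2) * -x.1 := by
  rw [mem_Vperp_iff] at hx
  simp only [b8, hyp6, dd, Pi.zero_apply, zero_mul, hx]
  ring

theorem b8_vv_sub_smul (n m : ℤ) (w : Lambda8) {x : Lambda8} (hx : x ∈ Vperp n) :
    b8 (vv n - m • w) x = m * -b8 w x := by
  rw [mem_Vperp_iff] at hx
  simp only [b8, hyp6, vv, Prod.fst_sub, Prod.snd_sub, Prod.smul_fst, Prod.smul_snd,
    Pi.sub_apply, Pi.smul_apply, Pi.zero_apply, smul_eq_mul, hx]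
  ring

theorem stmt11 (n : ℤ) (hn : 1 ≤ n) (hδ : dd n ∈ Vperp n)
    (hD : vv n - (n + 1) • w2 n ∈ Vperp n) :
    b8 (dd n) (dd n) = -(2 * n + 2) ∧
    b8 (vv n - (n + 1) • w2 n) (vv n - (n + 1) • w2 n) = -(2 * n + 2) ∧
    -- divisibility of `δ` in `v^⊥` is `2n+2`
    (∀ x ∈ Vperp n, (2 * n + 2) ∣ b8 (dd n) x) ∧
    (∃ x ∈ Vperp n, b8 (dd n) x = 2 * n + 2) ∧
    -- divisibility of `D₂` in `v^⊥` is `n+1`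
    (∀ x ∈ Vperp n, (n + 1) ∣ b8 (vv n - (n + 1) • w2 n) x) ∧
    (∃ x ∈ Vperp n, b8 (vv n - (n + 1) • w2 n) x = n + 1) ∧
    -- hence no isometry of `v^⊥` carries `δ` to `D₂`
    ¬ ∃ g : Vperp n ≃ₗ[ℤ] Vperp n,
        (∀ x y : Vperp n, b8 ((g x : Vperp n) : Lambda8) ((g y : Vperp n) : Lambda8)
          = b8 (x : Lambda8) (y : Lambda8)) ∧
        ((g ⟨dd n, hδ⟩ : Vperp n) : Lambda8) = vv n - (n + 1) • w2 n := by
  have hD_attained : ∃ x ∈ Vperp n, b8 (vv n - (n + 1) • w2 n) x = n + 1 := by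
    have hx : ((0, ![-1, 0, 0, 0, 0, 0], 0) : Lambda8) ∈ Vperp n := by simp [mem_Vperp_iff]
    exact ⟨_, hx, by rw [b8_vv_sub_smul n _ _ hx]; simp [b8, hyp6, w2]⟩
  refine ⟨?_, ?_, fun x hx => ⟨_, b8_dd hx⟩, ⟨-dd n, neg_mem hδ, ?_⟩,
    fun x hx => ⟨_, b8_vv_sub_smul n _ _ hx⟩, hD_attained, ?_⟩
  · rw [b8_dd hδ]
    simp [dd]
  · rw [b8_vv_sub_smul n _ _ hD]
    simp [b8, hyp6, w2, vv]
    ring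
  · rw [b8_dd (neg_mem hδ)]
    simp [dd]
  · rintro ⟨g, hg, hgδ⟩
    obtain ⟨x, hx, hDx⟩ := hD_attained
    have h := hg ⟨dd n, hδ⟩ (g.symm ⟨x, hx⟩)
    rw [hgδ, g.apply_symm_apply, hDx, b8_dd (g.symm ⟨x, hx⟩).2] at h
    have hdvd : 2 * n + 2 ∣ n + 1 := ⟨_, h⟩
    have := Int.le_of_dvd (by linarith) hdvd
    linarith
end

section
/- Set w^⊥ := {x ∈ Λ₂₄ : b(x,w) = 0} and D := w − 2s = (−3,−2H,−3). Then: (i) D is primitive in Λ₂₄; (ii) b(D,D) = −10; (iii) the set {x ∈ ℤw + ℤs : b(x,w) = 0} equals ℤD; (iv) b(D,x) is even for every x ∈ w^⊥, i.e. the divisibility of D in w^⊥ equals 2. (D is the wall divisor, coming from Meachan–Zhang's results, used to disprove Markman's conjecture that the monodromy group of O'Grady's ten dimensional manifold equals the full group of orientation preserving isometries.) -/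
/-- The lattice `Λ₂₄ = ℤ ⊕ ℤ²² ⊕ ℤ`, the Mukai lattice of a K3 surface. -/
abbrev Lambda24 : Type := ℤ × (Fin 22 → ℤ) × ℤ

/-- The Cartan matrix of the root system `E₈` (nodes `0,…,6` forming a chain,
node `7` attached to node `4`). -/
def E8M : Matrix (Fin 8) (Fin 8) ℤ :=
  !![ 2, -1,  0,  0,  0,  0,  0,  0;
     -1,  2, -1,  0,  0,  0,  0,  0;
      0, -1,  2, -1,  0,  0,  0,  0;
      0,  0, -1,  2, -1,  0,  0,  0;
      0,  0,  0, -1,  2, -1,  0, -1;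
      0,  0,  0,  0, -1,  2, -1,  0;
      0,  0,  0,  0,  0, -1,  2,  0;
      0,  0,  0,  0, -1,  0,  0,  2]

/-- The bilinear form `U³ ⊕ E₈(-1)²` on `ℤ²²`. -/
def pair22 (c c' : Fin 22 → ℤ) : ℤ :=
  c 0 * c' 1 + c 1 * c' 0 + c 2 * c' 3 + c 3 * c' 2 + c 4 * c' 5 + c 5 * c' 4
    - ∑ i : Fin 8, ∑ j : Fin 8,
        E8M i j * c ⟨6 + i.1, by omega⟩ * c' ⟨6 + j.1, by omega⟩
    - ∑ i : Fin 8, ∑ j : Fin 8,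
        E8M i j * c ⟨14 + i.1, by omega⟩ * c' ⟨14 + j.1, by omega⟩

/-- The Mukai pairing on `Λ₂₄`. -/
def b24 (x y : Lambda24) : ℤ := pair22 x.2.1 y.2.1 - x.1 * y.2.2 - y.1 * x.2.2

/-- The Mukai vector `w = (1,0,-1)` of square `2`. -/
def w24 : Lambda24 := (1, 0, -1)

/-- The polarisation class `H = (1,1,0,…,0) ∈ ℤ²²`, of square `2`. -/
def H24 : Fin 22 → ℤ := fun i => if (i : ℕ) < 2 then 1 else 0

/-- The Mukai vector `s = (2,H,1)` of square `-2` with `b(s,w) = 1`. -/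
def s24 : Lambda24 := (2, H24, 1)

theorem b24_w24 (x : Lambda24) : b24 x w24 = x.1 - x.2.2 := by
  simp [b24, pair22, w24]

theorem w24_sub_two_smul_s24 : w24 - 2 • s24 = (-3, (-2 : ℤ) • H24, -3) := by
  ext i <;> simp [w24, s24]

theorem pair22_smul_H24 (k : ℤ) (c : Fin 22 → ℤ) :
    pair22 (k • H24) c = k * (c 0 + c 1) := by
  have h6 (i : Fin 8) : ¬ 6 + (i : ℕ) < 2 := by omega
  have h14 (i : Fin 8) : ¬ 14 + (i : ℕ) < 2 := by omega
  simp only [pair22, H24, Pi.smul_apply, h6, h14]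
  simp
  ring

theorem b24_w24_sub_two_smul_s24 (x : Lambda24) :
    b24 (w24 - 2 • s24) x = 3 * (x.1 + x.2.2) - 2 * (x.2.1 0 + x.2.1 1) := by
  rw [w24_sub_two_smul_s24, b24, pair22_smul_H24]
  ring

theorem stmt13 :
    -- (i) `D = w - 2s = (-3,-2H,-3)` is primitive in `Λ₂₄`
    (¬ ∃ (m : ℤ) (x : Lambda24), 2 ≤ |m| ∧ w24 - 2 • s24 = m • x) ∧
    -- (ii) `D² = -10`
    b24 (w24 - 2 • s24) (w24 - 2 • s24) = -10 ∧
    -- (iii) `⟨w,s⟩ ∩ w^⊥ = ℤD`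
    ({x : Lambda24 | x ∈ Submodule.span ℤ ({w24, s24} : Set Lambda24) ∧ b24 x w24 = 0} =
      {x : Lambda24 | ∃ m : ℤ, x = m • (w24 - 2 • s24)}) ∧
    -- (iv) the divisibility of `D` in `w^⊥` is `2`
    (∀ x : Lambda24, b24 x w24 = 0 → 2 ∣ b24 (w24 - 2 • s24) x) ∧
    (∃ x : Lambda24, b24 x w24 = 0 ∧ b24 (w24 - 2 • s24) x = 2) := by
  refine ⟨?_, ?_, ?_, ?_, ?_⟩
  · rintro ⟨m, x, hm, h⟩
    rw [w24_sub_two_smul_s24] at h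
    have h3 : (-3 : ℤ) = m * x.1 := congrArg Prod.fst h
    have h2 : (-2 : ℤ) = m * x.2.1 0 := by
      simpa [H24] using congrFun (congrArg (fun y : Lambda24 => y.2.1) h) 0
    have hunit : m ∣ 1 := ⟨x.2.1 0 - x.1, by linarith⟩
    have := Int.le_of_dvd one_pos ((abs_dvd m 1).mpr hunit)
    omega
  · rw [b24_w24_sub_two_smul_s24]
    simp [w24, s24, H24]
  · ext x
    simp only [Set.mem_ofPred_eq, Submodule.mem_span_pair]
    constructor
    · rintro ⟨⟨a, c, rfl⟩, h⟩
      rw [b24_w24] at h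
      simp [w24, s24] at h
      obtain rfl : c = -2 * a := by linarith
      exact ⟨a, by module⟩
    · rintro ⟨m, rfl⟩
      refine ⟨⟨m, -2 * m, by module⟩, ?_⟩
      rw [b24_w24, w24_sub_two_smul_s24]
      simp
  · intro x h
    rw [b24_w24] at h
    rw [b24_w24_sub_two_smul_s24]
    omega
  · refine ⟨(1, Pi.single 0 2, 1), ?_, ?_⟩
    · simp [b24_w24]
    · rw [b24_w24_sub_two_smul_s24]
      simp
end
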